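/- Let G be an ancestral graph on vertex set [p] and 𝓘 a multiset of intervention targets that does not doubly-intervene on any node of G. Then G is maximal if and only if the anterior graph (G^𝓘)* of the interventional graph G^𝓘 is a maximal ancestral graph that is Markov equivalent to G^𝓘. -/

import Mathlib

/-
Common formalization infrastructure for loopless mixed graphs (LMGs),
m-separation, Markov equivalence, interventional graphs, ribbons,
ancestral graphs, colliders with order, and the head/tail factorization
machinery of acyclic directed mixed graphs (ADMGs), following
"Distributional Invariances and Interventional Markov Equivalence
for Mixed Graph Models" (Solus).
-/

open Relation

/-- An endpoint mark of an edge in a mixed graph: either a tail or an arrowhead. -/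
inductive Mark : Type
  | tail : Mark
  | arrow : Mark
  deriving DecidableEq

/-- A mixed graph on a vertex type `V`: `edge a b m₁ m₂` means there is an edge
between `a` and `b` carrying mark `m₁` at `a` and mark `m₂` at `b`.
Undirected edges are `(tail, tail)`, directed `a → b` is `(tail, arrow)`,
and bidirected is `(arrow, arrow)`. -/
structure MixedGraph (V : Type) : Type where
  edge : V → V → Mark → Mark → Prop

namespace MixedGraph

variable {V : Type}

/-- A loopless mixed graph: edges are symmetric (with endpoint marks swapped) and no loops. -/
def IsLMG (G : MixedGraph V) : Prop :=
  (∀ a b m₁ m₂, G.edge a b m₁ m₂ → G.edge b a m₂ m₁) ∧ ∀ a m₁ m₂, ¬ G.edge a a m₁ m₂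

/-- Two vertices are adjacent if there is some edge between them. -/
def adj (G : MixedGraph V) (a b : V) : Prop := ∃ m₁ m₂, G.edge a b m₁ m₂

/-- A simple mixed graph: at most one edge between any two nodes. -/
def Simple (G : MixedGraph V) : Prop :=
  ∀ a b m₁ m₂ n₁ n₂, G.edge a b m₁ m₂ → G.edge a b n₁ n₂ → m₁ = n₁ ∧ m₂ = n₂

/-- A directed edge `a → b`. -/
def dirEdge (G : MixedGraph V) (a b : V) : Prop := G.edge a b Mark.tail Mark.arrow

/-- A bidirected edge `a ↔ b`. -/
def bidirEdge (G : MixedGraph V) (a b : V) : Prop := G.edge a b Mark.arrow Mark.arrow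

/-- An undirected edge `a − b`. -/
def undirEdge (G : MixedGraph V) (a b : V) : Prop := G.edge a b Mark.tail Mark.tail

/-- `a` is an ancestor of `b` (reflexively: there is a directed path, possibly trivial). -/
def ancestor (G : MixedGraph V) (a b : V) : Prop := ReflTransGen G.dirEdge a b

/-- A node is selection adjacent when it is an endpoint of an undirected edge. -/
def selectionAdjacent (G : MixedGraph V) (a : V) : Prop := ∃ b, G.undirEdge a b ∨ G.undirEdge b a

/-- An ancestral graph: an LMG with no directed cycles, no bidirected edge with a
(nontrivial) directed path between its endpoints, and no arrowhead pointing into a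
selection adjacent node. -/
def IsAncestral (G : MixedGraph V) : Prop :=
  G.IsLMG ∧ (∀ a, ¬ TransGen G.dirEdge a a) ∧
    (∀ a b, G.bidirEdge a b → ¬ TransGen G.dirEdge a b ∧ ¬ TransGen G.dirEdge b a) ∧
    ∀ a, G.selectionAdjacent a → ∀ b m, ¬ G.edge b a m Mark.arrow

/-- An acyclic directed mixed graph: only directed and bidirected edges, no directed cycles. -/
def IsADMG (G : MixedGraph V) : Prop :=
  G.IsLMG ∧ (∀ a b m₁ m₂, G.edge a b m₁ m₂ → ¬ (m₁ = Mark.tail ∧ m₂ = Mark.tail)) ∧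
    ∀ a, ¬ TransGen G.dirEdge a a

/-- A directed acyclic graph: only directed edges, and no directed cycles. -/
def IsDAG (G : MixedGraph V) : Prop :=
  G.IsLMG ∧
    (∀ a b m₁ m₂, G.edge a b m₁ m₂ →
      (m₁ = Mark.tail ∧ m₂ = Mark.arrow) ∨ (m₁ = Mark.arrow ∧ m₂ = Mark.tail)) ∧
    ∀ a, ¬ TransGen G.dirEdge a a

/-- A directed ancestral graph: an ancestral graph with no undirected edges. -/
def IsDirectedAncestral (G : MixedGraph V) : Prop := G.IsAncestral ∧ ∀ a b, ¬ G.undirEdge a b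

/-- A walk in a mixed graph `G`, recording at each step the pair of endpoint marks used. -/
structure MWalk (G : MixedGraph V) : Type where
  len : ℕ
  vtx : ℕ → V
  mk₁ : ℕ → Mark
  mk₂ : ℕ → Mark
  isEdge : ∀ i, i < len → G.edge (vtx i) (vtx (i + 1)) (mk₁ i) (mk₂ i)

namespace MWalk

variable {G : MixedGraph V}

/-- The interior vertex at position `i` is a collider on the walk. -/
def colliderAt (w : MWalk G) (i : ℕ) : Prop :=
  0 < i ∧ i < w.len ∧ w.mk₂ (i - 1) = Mark.arrow ∧ w.mk₁ i = Mark.arrow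

/-- The walk is a path: all of its vertices are pairwise distinct. -/
def IsPath (w : MWalk G) : Prop :=
  ∀ i j, i ≤ w.len → j ≤ w.len → w.vtx i = w.vtx j → i = j

/-- The walk is m-connecting given `C`: all colliders are in `C` or ancestors of `C`,
all non-collider vertices are outside of `C`. -/
def mConnecting (w : MWalk G) (C : Set V) : Prop :=
  (∀ i, w.colliderAt i → ∃ c ∈ C, G.ancestor (w.vtx i) c) ∧
    ∀ i, i ≤ w.len → ¬ w.colliderAt i → w.vtx i ∉ C

end MWalk

/-- There is an m-connecting path between `a` and `b` given `C`. -/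
def mConnected (G : MixedGraph V) (a b : V) (C : Set V) : Prop :=
  ∃ w : MWalk G, w.IsPath ∧ w.vtx 0 = a ∧ w.vtx w.len = b ∧ w.mConnecting C

/-- `C` m-separates `A` and `B` in `G`. -/
def mSep (G : MixedGraph V) (A B C : Set V) : Prop := ∀ a ∈ A, ∀ b ∈ B, ¬ G.mConnected a b C

/-- The (formal) independence model `J(G)`: triples `⟨A,B∣C⟩` with `A,B` disjoint
and m-separated given `C`. -/
def indep (G : MixedGraph V) (A B C : Set V) : Prop := Disjoint A B ∧ G.mSep A B C

/-- Markov equivalence: equal independence models. -/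
def MarkovEquiv (G H : MixedGraph V) : Prop := ∀ A B C : Set V, G.indep A B C ↔ H.indep A B C

/-- The result of adding a single edge (with marks `m₁, m₂`) between `a` and `b`. -/
def addEdge (G : MixedGraph V) (a b : V) (m₁ m₂ : Mark) : MixedGraph V where
  edge x y n₁ n₂ := G.edge x y n₁ n₂ ∨ (x = a ∧ y = b ∧ n₁ = m₁ ∧ n₂ = m₂) ∨
    (x = b ∧ y = a ∧ n₁ = m₂ ∧ n₂ = m₁)

/-- A mixed graph is maximal if adding any edge between nonadjacent vertices changes
its independence model. -/
def IsMaximal (G : MixedGraph V) : Prop :=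
  ∀ a b, a ≠ b → ¬ G.adj a b → ∀ m₁ m₂, ¬ MarkovEquiv (G.addEdge a b m₁ m₂) G

/-- `G` is an (edge-)subgraph of `K` on the same vertex set. -/
def Subgraph (G K : MixedGraph V) : Prop := ∀ a b m₁ m₂, G.edge a b m₁ m₂ → K.edge a b m₁ m₂

/-- `K` is the maximal ancestral graph extension of the ancestral graph `G`:
a Markov equivalent maximal ancestral supergraph. -/
def IsMAGExtension (G K : MixedGraph V) : Prop :=
  Subgraph G K ∧ K.IsAncestral ∧ MarkovEquiv G K ∧ K.IsMaximal

/-- `G` contains a ribbon: a collider path `⟨i,j,k⟩` with no endpoint-identical edge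
between `i` and `k` such that `j` or a descendant of `j` is selection adjacent
or lies on a directed cycle. -/
def hasRibbon (G : MixedGraph V) : Prop :=
  ∃ i j k m₁ m₂, i ≠ k ∧ G.edge i j m₁ Mark.arrow ∧ G.edge j k Mark.arrow m₂ ∧
    ¬ G.edge i k m₁ m₂ ∧ ∃ d, G.ancestor j d ∧ (G.selectionAdjacent d ∨ TransGen G.dirEdge d d)

/-- Ribbonless graph. -/
def Ribbonless (G : MixedGraph V) : Prop := ¬ G.hasRibbon

/-- `K` is the maximal ribbonless extension of the ribbonless graph `G`. -/
def IsRGExtension (G K : MixedGraph V) : Prop :=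
  Subgraph G K ∧ K.Ribbonless ∧ MarkovEquiv G K ∧ K.IsMaximal

/-- `⟨i,j,k⟩` is a collider path (both edges have an arrowhead at `j`). -/
def isCollider (G : MixedGraph V) (i j k : V) : Prop :=
  ∃ m₁ m₂, G.edge i j m₁ Mark.arrow ∧ G.edge j k Mark.arrow m₂

/-- A v-structure: a collider whose endpoints are nonadjacent. -/
def isVStructure (G : MixedGraph V) (i j k : V) : Prop := G.isCollider i j k ∧ ¬ G.adj i k

/-- There is a discriminating path `⟨w 0, …, w m, w (m+1), w (m+2)⟩ = ⟨v₀,…,v_m,b,c⟩`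
for the triple `⟨i,j,k⟩`, all of whose intermediate triples satisfy `P`:
`v₀` and `c` are nonadjacent, `v₁,…,v_m` are parents of `c`, and the triples
`⟨v₀,v₁,v₂⟩, …, ⟨v_{m-1},v_m,b⟩` satisfy `P`. -/
def discPathFor (G : MixedGraph V) (P : V → V → V → Prop) (i j k : V) : Prop :=
  ∃ (m : ℕ) (w : ℕ → V), 1 ≤ m ∧
    ((w m = i ∧ w (m + 1) = j ∧ w (m + 2) = k) ∨ (w m = k ∧ w (m + 1) = j ∧ w (m + 2) = i)) ∧
    ¬ G.adj (w 0) (w (m + 2)) ∧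
    (∀ l, 1 ≤ l → l ≤ m → G.dirEdge (w l) (w (m + 2))) ∧
    (∀ l l', l ≤ m + 2 → l' ≤ m + 2 → w l = w l' → l = l') ∧
    ∀ l, l + 2 ≤ m + 1 → P (w l) (w (l + 1)) (w (l + 2))

/-- `⟨i,j,k⟩` is a collider with order at most `t`. Order `0` colliders are
v-structures; a collider has order at most `t+1` if it has order at most `t` or
lies at the end of a discriminating path all of whose intermediate triples are
colliders of order at most `t`. -/
def colliderOrderLE (G : MixedGraph V) : ℕ → V → V → V → Prop
  | 0, i, j, k => G.isCollider i j k ∧ ¬ G.adj i k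
  | t + 1, i, j, k =>
      colliderOrderLE G t i j k ∨
        (G.isCollider i j k ∧ G.discPathFor (colliderOrderLE G t) i j k)

/-- `⟨i,j,k⟩` is a collider with order (for some order). -/
def hasColliderWithOrder (G : MixedGraph V) (i j k : V) : Prop := ∃ t, G.colliderOrderLE t i j k

/-- `⟨i,j,k⟩` is a collider with order exactly `t`. -/
def colliderOrderEq (G : MixedGraph V) (t : ℕ) (i j k : V) : Prop :=
  G.colliderOrderLE t i j k ∧ ∀ s < t, ¬ G.colliderOrderLE s i j k

/-- `a` is anterior to `b`: there is a path from `a` to `b` consisting of undirected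
edges followed by a directed path toward `b`. -/
def anteriorTo (G : MixedGraph V) (a b : V) : Prop :=
  ∃ c, ReflTransGen G.undirEdge a c ∧ ReflTransGen G.dirEdge c b

/-- The closure of the set of selection adjacent nodes under the operation of
consecutively removing arrowheads pointing into such nodes (`i → j − k` becomes
`i − j − k`, creating the new selection adjacent node `i`). -/
inductive selClosure (G : MixedGraph V) : V → Prop
  | base (a b : V) : G.undirEdge a b → selClosure G a
  | base' (a b : V) : G.undirEdge b a → selClosure G a
  | step (a b : V) : G.dirEdge a b → selClosure G b → selClosure G a

/-- The anterior graph `G*` of `G`: consecutively remove all arrowheads pointing into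
nodes adjacent to an undirected edge. -/
def anteriorGraph (G : MixedGraph V) : MixedGraph V where
  edge a b m₁ m₂ := ∃ n₁ n₂, G.edge a b n₁ n₂ ∧
    ((selClosure G a ∧ m₁ = Mark.tail) ∨ (¬ selClosure G a ∧ m₁ = n₁)) ∧
    ((selClosure G b ∧ m₂ = Mark.tail) ∨ (¬ selClosure G b ∧ m₂ = n₂))

/-- The set of parents of `i`. -/
def parentsSet (G : MixedGraph V) (i : V) : Set V := {a | G.dirEdge a i}

/-- The set of spouses of `i`. -/
def spousesSet (G : MixedGraph V) (i : V) : Set V := {a | G.bidirEdge i a}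

/-- The set of ancestors of a set `S` (including `S` itself). -/
def ancSet (G : MixedGraph V) (S : Set V) : Set V := {a | ∃ s ∈ S, G.ancestor a s}

/-- A set is ancestrally closed when it equals its set of ancestors. -/
def AncestrallyClosed (G : MixedGraph V) (A : Set V) : Prop := A = G.ancSet A

/-- The district of `i` in the induced subgraph on `A`: the connected component of `i`
under bidirected edges within `A`. -/
def districtIn (G : MixedGraph V) (A : Set V) (i : V) : Set V :=
  {j | j ∈ A ∧ ReflTransGen (fun x y => x ∈ A ∧ y ∈ A ∧ G.bidirEdge x y) i j}

/-- Two vertices lie in a common district of `G`. -/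
def sameDistrict (G : MixedGraph V) (a b : V) : Prop :=
  ∃ d, a ∈ G.districtIn Set.univ d ∧ b ∈ G.districtIn Set.univ d

/-- The barren subset of `A`: those `x ∈ A` with no proper descendants inside `A`. -/
def barren (G : MixedGraph V) (A : Set V) : Set V :=
  {x | x ∈ A ∧ ∀ y ∈ A, G.ancestor x y → y = x}

/-- The head-extraction step `Φ_G(A)`. -/
def headsStep (G : MixedGraph V) (A : Set V) : Set (Set V) :=
  {H | H.Nonempty ∧ H = ⋂ i ∈ H, G.barren (G.ancSet (G.districtIn A i))}

/-- The residual step `Ψ_G(A)`. -/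
def psi (G : MixedGraph V) (A : Set V) : Set V := A \ ⋃ H ∈ G.headsStep A, H

/-- The partition `[A]_G` of `A` into heads. -/
def heads (G : MixedGraph V) (A : Set V) : Set (Set V) :=
  {H | ∃ n : ℕ, H ∈ G.headsStep ((G.psi)^[n] A)}

/-- `dis_{an(H)}(H)`: the union of the districts of the elements of `H` in the induced
subgraph on the ancestors of `H`. -/
def headDistrict (G : MixedGraph V) (H : Set V) : Set V :=
  ⋃ i ∈ H, G.districtIn (G.ancSet H) i

/-- The tail of a head `H`: `(dis_{an(H)}(H) \ H) ∪ pa_G(dis_{an(H)}(H))`. -/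
def tailOf (G : MixedGraph V) (H : Set V) : Set V :=
  (G.headDistrict H \ H) ∪ {a | ∃ s ∈ G.headDistrict H, G.dirEdge a s}

end MixedGraph

/-- The index set `W_𝓘` of intervention nodes: (occurrences of) nonempty targets. -/
abbrev InterventionIndex {V ι : Type} (targets : ι → Set V) : Type :=
  {k : ι // (targets k).Nonempty}

/-- The interventional graph `G^𝓘`: add a source node `ω_I` for each nonempty target
`I ∈ 𝓘` together with the edges `ω_I → i` for all `i ∈ I`. -/
def interventionGraph {V ι : Type} (G : MixedGraph V) (targets : ι → Set V) :
    MixedGraph (V ⊕ InterventionIndex targets) where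
  edge a b m₁ m₂ :=
    match a, b with
    | Sum.inl a, Sum.inl b => G.edge a b m₁ m₂
    | Sum.inr k, Sum.inl b => b ∈ targets k.1 ∧ m₁ = Mark.tail ∧ m₂ = Mark.arrow
    | Sum.inl a, Sum.inr k => a ∈ targets k.1 ∧ m₁ = Mark.arrow ∧ m₂ = Mark.tail
    | Sum.inr _, Sum.inr _ => False

/-- The multiset of targets doubly-intervenes on `i`: two distinct elements of the
multiset both contain `i`. -/
def doublyIntervenes {V ι : Type} (targets : ι → Set V) (i : V) : Prop :=
  ∃ k k' : ι, k ≠ k' ∧ i ∈ targets k ∧ i ∈ targets k'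

/-- `𝓘`-Markov equivalence: the interventional graphs have the same independence models. -/
def IMarkovEquiv {V ι : Type} (G H : MixedGraph V) (targets : ι → Set V) : Prop :=
  MixedGraph.MarkovEquiv (interventionGraph G targets) (interventionGraph H targets)

/-- An `𝓘`-collider with order: a collider with order in `G^𝓘` that is not a collider
with order in `G`. -/
def IColliderWithOrder {V ι : Type} (G : MixedGraph V) (targets : ι → Set V)
    (i j k : V ⊕ InterventionIndex targets) : Prop :=
  (interventionGraph G targets).hasColliderWithOrder i j k ∧
    ¬ ∃ i' j' k' : V, i = Sum.inl i' ∧ j = Sum.inl j' ∧ k = Sum.inl k' ∧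
      G.hasColliderWithOrder i' j' k'

/-- An `𝓘`-v-structure: a v-structure of `G^𝓘` with an endpoint in `W_𝓘`. -/
def IVStructure {V ι : Type} (G : MixedGraph V) (targets : ι → Set V)
    (i j k : V ⊕ InterventionIndex targets) : Prop :=
  (interventionGraph G targets).isVStructure i j k ∧
    ((∃ κ, i = Sum.inr κ) ∨ (∃ κ, k = Sum.inr κ))

/-- The induced subgraph of a graph on `[p] ∪ W_𝓘` on the observed vertex set `[p]`. -/
def observedPart {V ι : Type} {targets : ι → Set V}
    (K : MixedGraph (V ⊕ InterventionIndex targets)) : MixedGraph V where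
  edge a b m₁ m₂ := K.edge (Sum.inl a) (Sum.inl b) m₁ m₂

namespace MixedGraph

variable {V : Type}

theorem mem_ancSet_of_mem {G : MixedGraph V} {C : Set V} {u : V} (h : u ∈ C) :
    u ∈ G.ancSet C :=
  ⟨u, h, ReflTransGen.refl⟩

theorem mem_ancSet_of_ancestor {G : MixedGraph V} {C : Set V} {u v : V}
    (h : G.ancestor u v) (hv : v ∈ G.ancSet C) : u ∈ G.ancSet C := by
  obtain ⟨c, hc, hvc⟩ := hv
  exact ⟨c, hc, ReflTransGen.trans h hvc⟩

/-- A walk entering `u` with mark `n` and leaving it with mark `m` is not blocked at `u`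
by `C`. -/
def Passes (G : MixedGraph V) (C : Set V) (u : V) (n m : Mark) : Prop :=
  (n = Mark.arrow ∧ m = Mark.arrow → u ∈ G.ancSet C) ∧
    (¬ (n = Mark.arrow ∧ m = Mark.arrow) → u ∉ C)

theorem passes_tail_left {G : MixedGraph V} {C : Set V} {u : V} {m : Mark} :
    G.Passes C u Mark.tail m ↔ u ∉ C := by
  simp [Passes]

theorem passes_tail_right {G : MixedGraph V} {C : Set V} {u : V} {m : Mark} :
    G.Passes C u m Mark.tail ↔ u ∉ C := by
  simp [Passes]

theorem passes_arrow_arrow {G : MixedGraph V} {C : Set V} {u : V} :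
    G.Passes C u Mark.arrow Mark.arrow ↔ u ∈ G.ancSet C := by
  simp [Passes]

theorem passes_of_mem_of_notMem {G : MixedGraph V} {C : Set V} {u : V} {n m : Mark}
    (h : u ∈ G.ancSet C) (h' : u ∉ C) : G.Passes C u n m :=
  ⟨fun _ => h, fun _ => h'⟩

/-- One step of an m-connecting walk given `C`; a state is a vertex together with the mark
with which the walk has entered it. -/
def Step (G : MixedGraph V) (C : Set V) (s t : V × Mark) : Prop :=
  ∃ m, G.edge s.1 t.1 m t.2 ∧ G.Passes C s.1 s.2 m

/-- A walk from `x` not blocked by `C` can enter `u` with mark `n`; the walk starts as though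
it had entered `x` with a tail. -/
def Reach (G : MixedGraph V) (C : Set V) (x u : V) (n : Mark) : Prop :=
  ReflTransGen (G.Step C) (x, Mark.tail) (u, n)

theorem Reach.step {G : MixedGraph V} {C : Set V} {x u v : V} {n m k : Mark}
    (h : G.Reach C x u n) (he : G.edge u v m k) (hp : G.Passes C u n m) : G.Reach C x v k :=
  ReflTransGen.tail h ⟨m, he, hp⟩

namespace MWalk

variable {G : MixedGraph V}

/-- The mark with which a walk enters its `i`-th vertex, with a tail at the start. -/
def inMark (w : MWalk G) (i : ℕ) : Mark := if i = 0 then Mark.tail else w.mk₂ (i - 1)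

@[simp] theorem inMark_zero (w : MWalk G) : w.inMark 0 = Mark.tail := rfl

@[simp] theorem inMark_succ (w : MWalk G) (i : ℕ) : w.inMark (i + 1) = w.mk₂ i := by
  simp [inMark]

theorem inMark_of_pos (w : MWalk G) {i : ℕ} (h : 0 < i) : w.inMark i = w.mk₂ (i - 1) := by
  simp [inMark, h.ne']

theorem colliderAt_iff (w : MWalk G) {i : ℕ} (hi : i < w.len) :
    w.colliderAt i ↔ w.inMark i = Mark.arrow ∧ w.mk₁ i = Mark.arrow := by
  rcases Nat.eq_zero_or_pos i with rfl | h
  · simp [colliderAt]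
  · simp [colliderAt, inMark_of_pos w h, h, hi]

theorem mConnecting_iff (w : MWalk G) (C : Set V) :
    w.mConnecting C ↔
      (∀ i, i < w.len → G.Passes C (w.vtx i) (w.inMark i) (w.mk₁ i)) ∧ w.vtx w.len ∉ C := by
  constructor
  · rintro ⟨h1, h2⟩
    refine ⟨fun i hi => ⟨fun h => h1 i ((w.colliderAt_iff hi).2 h),
      fun h => h2 i hi.le fun h' => h ((w.colliderAt_iff hi).1 h')⟩, h2 _ le_rfl ?_⟩
    exact fun h => absurd h.2.1 (lt_irrefl _)
  · rintro ⟨h1, h2⟩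
    refine ⟨fun i hi => (h1 i hi.2.1).1 ((w.colliderAt_iff hi.2.1).1 hi), fun i hi hc => ?_⟩
    rcases hi.lt_or_eq with hi | rfl
    · exact (h1 i hi).2 fun h => hc ((w.colliderAt_iff hi).2 h)
    · exact h2

/-- The walk traversed backwards. -/
def reverse (w : MWalk G) (hG : G.IsLMG) : MWalk G where
  len := w.len
  vtx i := w.vtx (w.len - i)
  mk₁ i := w.mk₂ (w.len - 1 - i)
  mk₂ i := w.mk₁ (w.len - 1 - i)
  isEdge i hi := by
    have h := hG.1 _ _ _ _ (w.isEdge (w.len - 1 - i) (by omega))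
    rw [show w.len - 1 - i + 1 = w.len - i by omega] at h
    rwa [show w.len - (i + 1) = w.len - 1 - i by omega]

theorem colliderAt_reverse (w : MWalk G) (hG : G.IsLMG) {i : ℕ} (hi : i ≤ w.len) :
    (w.reverse hG).colliderAt i ↔ w.colliderAt (w.len - i) := by
  simp only [colliderAt, reverse]
  constructor
  · rintro ⟨h1, h2, h3, h4⟩
    refine ⟨by omega, by omega, ?_, ?_⟩
    · rwa [show w.len - i - 1 = w.len - 1 - i by omega]
    · rwa [show w.len - i = w.len - 1 - (i - 1) by omega]
  · rintro ⟨h1, h2, h3, h4⟩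
    refine ⟨by omega, by omega, ?_, ?_⟩
    · rwa [show w.len - 1 - (i - 1) = w.len - i by omega]
    · rwa [show w.len - 1 - i = w.len - i - 1 by omega]

theorem mConnecting_reverse (w : MWalk G) (hG : G.IsLMG) {C : Set V} (h : w.mConnecting C) :
    (w.reverse hG).mConnecting C := by
  refine ⟨fun i hi => h.1 _ ((w.colliderAt_reverse hG hi.2.1.le).1 hi), fun i hi hc => ?_⟩
  exact h.2 _ (Nat.sub_le _ _) fun h' => hc ((w.colliderAt_reverse hG hi).2 h')

theorem isPath_reverse (w : MWalk G) (hG : G.IsLMG) (h : w.IsPath) :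
    (w.reverse hG).IsPath := by
  intro i j hi hj hij
  have hi' : i ≤ w.len := hi
  have hj' : j ≤ w.len := hj
  have := h (w.len - i) (w.len - j) (Nat.sub_le _ _) (Nat.sub_le _ _) hij
  omega

/-- The walk extended by one edge. -/
def snoc (w : MWalk G) {v : V} {m n : Mark} (h : G.edge (w.vtx w.len) v m n) : MWalk G where
  len := w.len + 1
  vtx i := if i ≤ w.len then w.vtx i else v
  mk₁ i := if i < w.len then w.mk₁ i else m
  mk₂ i := if i < w.len then w.mk₂ i else n
  isEdge i hi := by
    rcases (Nat.lt_succ_iff.1 hi).lt_or_eq with hi | rfl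
    · simpa [hi, hi.le, Nat.succ_le_of_lt hi] using w.isEdge i hi
    · simpa using h

/-- The walk with the vertices after position `i` up to position `i + d` removed. -/
def cut (w : MWalk G) (i d : ℕ) (hd : i + d ≤ w.len) (h : w.vtx i = w.vtx (i + d)) :
    MWalk G where
  len := w.len - d
  vtx k := if k ≤ i then w.vtx k else w.vtx (k + d)
  mk₁ k := if k < i then w.mk₁ k else w.mk₁ (k + d)
  mk₂ k := if k < i then w.mk₂ k else w.mk₂ (k + d)
  isEdge k hk := by
    rcases lt_trichotomy k i with hk' | rfl | hk'
    · simpa [hk', hk'.le, Nat.succ_le_of_lt hk'] using w.isEdge k (by omega)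
    · have := w.isEdge (k + d) (by omega)
      simpa [h, show k + 1 + d = k + d + 1 by omega] using this
    · have := w.isEdge (k + d) (by omega)
      simpa [show ¬ k ≤ i by omega, show ¬ k + 1 ≤ i by omega, show ¬ k < i by omega,
        show k + 1 + d = k + d + 1 by omega] using this

end MWalk

theorem mConnected.symm {G : MixedGraph V} (hG : G.IsLMG) {a b : V} {C : Set V}
    (h : G.mConnected a b C) : G.mConnected b a C := by
  obtain ⟨w, hp, h0, hl, hc⟩ := h
  exact ⟨w.reverse hG, w.isPath_reverse hG hp, by simpa [MWalk.reverse] using hl,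
    by simpa [MWalk.reverse] using h0, w.mConnecting_reverse hG hc⟩

theorem exists_reach_of_mConnected {G : MixedGraph V} {a b : V} {C : Set V}
    (h : G.mConnected a b C) : b ∉ C ∧ ∃ n, G.Reach C a b n := by
  obtain ⟨w, -, rfl, rfl, hc⟩ := h
  obtain ⟨h1, h2⟩ := (w.mConnecting_iff C).1 hc
  have key : ∀ i, i ≤ w.len → G.Reach C (w.vtx 0) (w.vtx i) (w.inMark i) := by
    intro i
    induction i with
    | zero => exact fun _ => ReflTransGen.refl
    | succ i ih =>
      intro hi
      rw [MWalk.inMark_succ]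
      exact (ih (by omega)).step (w.isEdge i hi) (h1 i hi)
  exact ⟨h2, _, key _ le_rfl⟩

theorem Reach.exists_walk {G : MixedGraph V} {a b : V} {C : Set V} {n : Mark}
    (h : G.Reach C a b n) (hb : b ∉ C) :
    ∃ w : MWalk G, w.vtx 0 = a ∧ w.vtx w.len = b ∧ w.mConnecting C := by
  have key : ∀ s : V × Mark, ReflTransGen (G.Step C) (a, Mark.tail) s →
      ∃ w : MWalk G, w.vtx 0 = a ∧ w.vtx w.len = s.1 ∧ w.inMark w.len = s.2 ∧
        ∀ i, i < w.len → G.Passes C (w.vtx i) (w.inMark i) (w.mk₁ i) := by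
    intro s hs
    induction hs with
    | refl =>
      exact ⟨⟨0, fun _ => a, fun _ => Mark.tail, fun _ => Mark.tail,
        fun i hi => absurd hi (Nat.not_lt_zero i)⟩, rfl, rfl, rfl,
        fun i hi => absurd hi (Nat.not_lt_zero i)⟩
    | @tail s t _ hst ih =>
      obtain ⟨w, h0, hl, hm, hp⟩ := ih
      obtain ⟨m, he, hpm⟩ := hst
      have he' : G.edge (w.vtx w.len) t.1 m t.2 := hl ▸ he
      refine ⟨w.snoc he', by simpa [MWalk.snoc] using h0, by simp [MWalk.snoc],
        by simp [MWalk.snoc, MWalk.inMark], fun i hi => ?_⟩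
      have hin : (w.snoc he').inMark i = w.inMark i := by
        have : i - 1 < w.len ∨ i = 0 := by
          have : i < w.len + 1 := hi
          omega
        rcases this with h | h <;> simp [MWalk.inMark, MWalk.snoc, h]
      rw [hin]
      rcases (Nat.lt_succ_iff.1 hi).lt_or_eq with hi | rfl
      · simpa [MWalk.snoc, hi, hi.le] using hp i hi
      · simpa [MWalk.snoc, hm, hl] using hpm
  obtain ⟨w, h0, hl, -, hp⟩ := key _ h
  exact ⟨w, h0, hl, (w.mConnecting_iff C).2 ⟨hp, hl ▸ hb⟩⟩

theorem MWalk.tail_follow {G : MixedGraph V} (hG : G.IsAncestral) (w : MWalk G) {C : Set V}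
    (hw : w.mConnecting C) {i : ℕ} (hi : w.mk₁ i = Mark.tail)
    (hs : ¬ G.selectionAdjacent (w.vtx i)) {k : ℕ} (hik : i ≤ k) (hk : k < w.len) :
    w.vtx i ∈ G.ancSet C ∨
      (w.mk₂ k = Mark.arrow ∧ G.ancestor (w.vtx i) (w.vtx (k + 1))) := by
  induction k, hik using Nat.le_induction with
  | base =>
    right
    have he := w.isEdge i hk
    rw [hi] at he
    cases hm : w.mk₂ i with
    | tail => exact absurd ⟨_, Or.inl (hm ▸ he)⟩ hs
    | arrow => exact ⟨rfl, ReflTransGen.single (by rw [hm] at he; exact he)⟩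
  | succ k hik ih =>
    rcases ih (by omega) with h | ⟨hm, ha⟩
    · exact Or.inl h
    have he := w.isEdge (k + 1) hk
    cases hm1 : w.mk₁ (k + 1) with
    | arrow =>
      exact Or.inl (mem_ancSet_of_ancestor ha (hw.1 (k + 1) ⟨by omega, hk, hm, hm1⟩))
    | tail =>
      right
      rw [hm1] at he
      cases hm2 : w.mk₂ (k + 1) with
      | tail =>
        exact absurd (hm ▸ w.isEdge k (by omega))
          (hG.2.2.2 _ ⟨_, Or.inl (hm2 ▸ he)⟩ _ _)
      | arrow => exact ⟨rfl, ReflTransGen.tail ha (by rw [hm2] at he; exact he)⟩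

theorem MWalk.mConnecting_cut {G : MixedGraph V} (hG : G.IsAncestral) (w : MWalk G)
    {C : Set V} (hw : w.mConnecting C) {i d : ℕ} (hd : i + d ≤ w.len) (hpos : 0 < d)
    (h : w.vtx i = w.vtx (i + d)) : (w.cut i d hd h).mConnecting C := by
  obtain ⟨hp, hl⟩ := (w.mConnecting_iff C).1 hw
  refine ((w.cut i d hd h).mConnecting_iff C).2 ⟨fun k hk => ?_, ?_⟩
  · have hk' : k < w.len - d := hk
    rcases lt_trichotomy k i with hki | rfl | hki
    · have hin : (w.cut i d hd h).inMark k = w.inMark k := by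
        rcases Nat.eq_zero_or_pos k with rfl | h0
        · rfl
        · simp [inMark, cut, show k - 1 < i by omega]
      rw [hin]
      simpa [cut, hki, hki.le] using hp k (by omega)
    · have hin : (w.cut k d hd h).inMark k = w.inMark k := by
        rcases Nat.eq_zero_or_pos k with rfl | h0
        · rfl
        · simp [inMark, cut, h0]
      rw [hin]
      have h1 := hp k (by omega)
      have h2 := hp (k + d) (by omega)
      rw [← h] at h2
      suffices G.Passes C (w.vtx k) (w.inMark k) (w.mk₁ (k + d)) by simpa [cut] using this
      cases hm : w.inMark k with
      | tail => rw [hm, passes_tail_left] at h1; rwa [passes_tail_left]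
      | arrow =>
        cases hn : w.mk₁ (k + d) with
        | tail => rw [hn, passes_tail_right] at h2; rwa [passes_tail_right]
        | arrow =>
          rw [passes_arrow_arrow]
          rw [hm] at h1
          rw [hn] at h2
          cases hm' : w.mk₁ k with
          | arrow => rwa [hm', passes_arrow_arrow] at h1
          | tail =>
            cases hn' : w.inMark (k + d) with
            | arrow => rwa [hn', passes_arrow_arrow] at h2
            | tail =>
              have hk0 : 0 < k := by
                rcases Nat.eq_zero_or_pos k with rfl | h0
                · simp at hm
                · exact h0
              have he := w.isEdge (k - 1) (by omega)
              rw [← inMark_of_pos w hk0, hm, Nat.sub_add_cancel hk0] at he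
              rcases w.tail_follow hG hw hm' (fun hs => hG.2.2.2 _ hs _ _ he)
                (show k ≤ k + d - 1 by omega) (by omega) with h' | ⟨h', -⟩
              · exact h'
              · rw [inMark_of_pos w (by omega), h'] at hn'
                exact absurd hn' (by simp)
    · have hin : (w.cut i d hd h).inMark k = w.inMark (k + d) := by
        simp [inMark, cut, show ¬ k - 1 < i by omega, show k ≠ 0 by omega,
          show k - 1 + d = k + d - 1 by omega]
      rw [hin]
      simpa [cut, show ¬ k ≤ i by omega, show ¬ k < i by omega] using hp (k + d) (by omega)
  · rcases Nat.lt_or_ge i (w.len - d) with h' | h'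
    · simpa [cut, show ¬ w.len - d ≤ i by omega, show w.len - d + d = w.len by omega] using hl
    · have : w.len = i + d := by omega
      rw [this, ← h] at hl
      simpa [cut, h', show w.len - d = i by omega] using hl

theorem mConnected_of_walk {G : MixedGraph V} (hG : G.IsAncestral) {a b : V} {C : Set V}
    (h : ∃ w : MWalk G, w.vtx 0 = a ∧ w.vtx w.len = b ∧ w.mConnecting C) :
    G.mConnected a b C := by
  obtain ⟨w, h0, hl, hc⟩ := h
  induction hn : w.len using Nat.strong_induction_on generalizing w with
  | _ n ih =>
    by_cases hp : w.IsPath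
    · exact ⟨w, hp, h0, hl, hc⟩
    · have : ∃ i d, 0 < d ∧ i + d ≤ w.len ∧ w.vtx i = w.vtx (i + d) := by
        simp only [MWalk.IsPath, not_forall] at hp
        obtain ⟨i, j, hi, hj, hij, hne⟩ := hp
        rcases Nat.lt_or_gt_of_ne hne with h | h
        · exact ⟨i, j - i, by omega, by omega, by rw [hij]; congr 1; omega⟩
        · exact ⟨j, i - j, by omega, by omega, by rw [← hij]; congr 1; omega⟩
      obtain ⟨i, d, hd, hid, hv⟩ := this
      refine ih (w.len - d) (by omega) (w.cut i d hid hv) (by simpa [MWalk.cut] using h0) ?_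
        (w.mConnecting_cut hG hc hid hd hv) rfl
      rw [← hl]
      rcases Nat.lt_or_ge i (w.len - d) with h' | h'
      · simp [MWalk.cut, show ¬ w.len - d ≤ i by omega, show w.len - d + d = w.len by omega]
      · have h1 : w.len - d = i := by omega
        have h2 : w.len = i + d := by omega
        simp only [MWalk.cut, h1, le_refl, if_true]
        rw [hv, ← h2]

theorem Reach.mConnected {G : MixedGraph V} (hG : G.IsAncestral) {a b : V} {C : Set V}
    {n : Mark} (h : G.Reach C a b n) (hb : b ∉ C) : G.mConnected a b C :=
  mConnected_of_walk hG (h.exists_walk hb)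

theorem transGen_of_ancestor {G : MixedGraph V} {a b : V} (h : G.ancestor a b) (hne : a ≠ b) :
    TransGen G.dirEdge a b := by
  rcases reflTransGen_iff_eq_or_transGen.1 h with h | h
  · exact absurd h.symm hne
  · exact h

theorem IsAncestral.not_ancestor_symm {G : MixedGraph V} (hG : G.IsAncestral) {a b : V}
    (h : G.ancestor a b) (hne : a ≠ b) : ¬ G.ancestor b a :=
  fun h' => hG.2.1 a ((transGen_of_ancestor h hne).trans_left h')

theorem IsAncestral.eq_of_ancestor_of_selectionAdjacent {G : MixedGraph V}
    (hG : G.IsAncestral) {a b : V} (h : G.ancestor a b) (hb : G.selectionAdjacent b) :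
    a = b := by
  rcases ReflTransGen.cases_tail h with h | ⟨c, -, hc⟩
  · exact h.symm
  · exact absurd hc (hG.2.2.2 b hb c _)

theorem IsAncestral.not_ancestor_of_edge {G : MixedGraph V} (hG : G.IsAncestral) {a b : V}
    {m : Mark} (h : G.edge a b Mark.arrow m) : ¬ G.ancestor a b := by
  intro ha
  have hne : a ≠ b := by rintro rfl; exact hG.1.2 _ _ _ h
  have ht := transGen_of_ancestor ha hne
  cases m with
  | tail => exact hG.2.1 a (ht.tail (hG.1.1 _ _ _ _ h))
  | arrow => exact (hG.2.2.1 a b h).1 ht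

/-- `a` and `b` are m-separated by some set containing neither of them. -/
def Separable (G : MixedGraph V) (a b : V) : Prop :=
  ∃ C : Set V, a ∉ C ∧ b ∉ C ∧ ¬ G.mConnected a b C

theorem Separable.symm {G : MixedGraph V} (hG : G.IsLMG) {a b : V} (h : G.Separable a b) :
    G.Separable b a := by
  obtain ⟨C, ha, hb, h⟩ := h
  exact ⟨C, hb, ha, fun h' => h (h'.symm hG)⟩

namespace MWalk

variable {G : MixedGraph V}

/-- A primitive inducing walk: it has inner vertices, all of which are colliders, distinct
from both endpoints, and ancestors of an endpoint. -/
def IsInducing (w : MWalk G) : Prop :=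
  2 ≤ w.len ∧ ∀ i, 0 < i → i < w.len → w.colliderAt i ∧ w.vtx i ≠ w.vtx 0 ∧
    w.vtx i ≠ w.vtx w.len ∧ (G.ancestor (w.vtx i) (w.vtx 0) ∨ G.ancestor (w.vtx i) (w.vtx w.len))

theorem IsInducing.reverse {w : MWalk G} (hw : w.IsInducing) (hG : G.IsLMG) :
    (w.reverse hG).IsInducing := by
  refine ⟨hw.1, fun i h0 hi => ?_⟩
  have hi' : i < w.len := hi
  obtain ⟨h1, h2, h3, h4⟩ := hw.2 (w.len - i) (by omega) (by omega)
  exact ⟨(w.colliderAt_reverse hG hi'.le).2 h1, by simpa [MWalk.reverse] using h3,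
    by simpa [MWalk.reverse] using h2, by simpa [MWalk.reverse] using h4.symm⟩

end MWalk

/-- A set separating any two separable vertices `a` and `b` of an ancestral graph. -/
def candidateSeparator (G : MixedGraph V) (a b : V) : Set V :=
  {x | (G.ancestor x a ∨ G.ancestor x b ∨ G.selectionAdjacent x) ∧ x ≠ a ∧ x ≠ b}

theorem IsAncestral.ancestor_or_of_mem_ancSet_candidateSeparator {G : MixedGraph V}
    (hG : G.IsAncestral) {a b v : V} (hv : v ∈ G.ancSet (G.candidateSeparator a b))
    (hs : ¬ G.selectionAdjacent v) : G.ancestor v a ∨ G.ancestor v b := by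
  obtain ⟨c, ⟨hc | hc | hc, -, -⟩, hvc⟩ := hv
  · exact Or.inl (ReflTransGen.trans hvc hc)
  · exact Or.inr (ReflTransGen.trans hvc hc)
  · exact absurd (hG.eq_of_ancestor_of_selectionAdjacent hvc hc ▸ hc) hs

theorem MWalk.ancestor_of_tail {G : MixedGraph V} (hG : G.IsAncestral) (w : MWalk G)
    (hc : w.mConnecting (G.candidateSeparator (w.vtx 0) (w.vtx w.len))) {i : ℕ}
    (hi : i < w.len) (ht : w.mk₁ i = Mark.tail) (hs : ¬ G.selectionAdjacent (w.vtx i)) :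
    G.ancestor (w.vtx i) (w.vtx 0) ∨ G.ancestor (w.vtx i) (w.vtx w.len) := by
  rcases w.tail_follow hG hc ht hs (show i ≤ w.len - 1 by omega) (by omega) with h | ⟨-, h⟩
  · exact hG.ancestor_or_of_mem_ancSet_candidateSeparator h hs
  · rw [Nat.sub_add_cancel (by omega)] at h
    exact Or.inr h

theorem candidateSeparator_comm (G : MixedGraph V) (a b : V) :
    G.candidateSeparator a b = G.candidateSeparator b a := by
  ext x
  simp only [candidateSeparator, Set.mem_ofPred_eq]
  tauto

theorem IsAncestral.exists_isInducing {G : MixedGraph V} (hG : G.IsAncestral) {a b : V}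
    (hne : a ≠ b) (hadj : ¬ G.adj a b) (hsep : ¬ G.Separable a b) :
    ∃ w : MWalk G, w.vtx 0 = a ∧ w.vtx w.len = b ∧ w.IsInducing := by
  have hcon : G.mConnected a b (G.candidateSeparator a b) := by
    by_contra h
    exact hsep ⟨_, fun h => h.2.1 rfl, fun h => h.2.2 rfl, h⟩
  obtain ⟨w, hp, rfl, rfl, hc⟩ := hcon
  have hlen : 2 ≤ w.len := by
    by_contra hlt
    rcases (by omega : w.len = 0 ∨ w.len = 1) with h | h
    · exact hne (by rw [h])
    · have := w.isEdge 0 (by omega)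
      exact hadj ⟨_, _, by rw [h]; exact this⟩
  refine ⟨w, rfl, rfl, hlen, fun i h0 hi => ?_⟩
  have hn0 : w.vtx i ≠ w.vtx 0 := fun h => h0.ne' (hp _ _ hi.le (Nat.zero_le _) h)
  have hnl : w.vtx i ≠ w.vtx w.len := fun h => hi.ne (hp _ _ hi.le le_rfl h)
  by_cases hcol : w.colliderAt i
  · refine ⟨hcol, hn0, hnl, ?_⟩
    have hs : ¬ G.selectionAdjacent (w.vtx i) := by
      intro hs
      have he := w.isEdge (i - 1) (by omega)
      rw [hcol.2.2.1, Nat.sub_add_cancel h0] at he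
      exact hG.2.2.2 _ hs _ _ he
    exact hG.ancestor_or_of_mem_ancSet_candidateSeparator (hc.1 i hcol) hs
  · exfalso
    have hout := hc.2 i hi.le hcol
    have hout' : ¬ (G.ancestor (w.vtx i) (w.vtx 0) ∨ G.ancestor (w.vtx i) (w.vtx w.len) ∨
        G.selectionAdjacent (w.vtx i)) := fun h => hout ⟨h, hn0, hnl⟩
    push Not at hout'
    obtain ⟨ha, hb, hs⟩ := hout'
    cases h1 : w.mk₁ i with
    | tail => exact (w.ancestor_of_tail hG hc hi h1 hs).elim ha hb
    | arrow =>
      cases h2 : w.mk₂ (i - 1) with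
      | arrow => exact hcol ⟨h0, hi, h2, h1⟩
      | tail =>
        have hc' := w.mConnecting_reverse hG.1 hc
        rw [candidateSeparator_comm] at hc'
        have := (w.reverse hG.1).ancestor_of_tail hG
          (by simpa [MWalk.reverse] using hc') (i := w.len - i)
          (show w.len - i < w.len by omega)
          (by simpa [MWalk.reverse, show w.len - 1 - (w.len - i) = i - 1 by omega] using h2)
          (by simpa [MWalk.reverse, show w.len - (w.len - i) = i by omega] using hs)
        simp only [MWalk.reverse, show w.len - (w.len - i) = i by omega, Nat.sub_zero,
          Nat.sub_self] at this
        exact this.elim hb ha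

theorem Reach.forward {G : MixedGraph V} {C : Set V} {x v t : V} {n : Mark}
    (h : G.Reach C x v n) (hv : v ∉ G.ancSet C) (ht : TransGen G.dirEdge v t) :
    G.Reach C x t Mark.arrow := by
  induction ht with
  | single he =>
    exact h.step he (passes_tail_right.2 fun hC => hv (mem_ancSet_of_mem hC))
  | @tail u t hvu he ih =>
    exact ih.step he (passes_tail_right.2 fun hC => hv ⟨u, hC, hvu.to_reflTransGen⟩)

theorem Reach.backward {G : MixedGraph V} (hG : G.IsLMG) {C : Set V} {x s v : V} {n : Mark}
    (h : G.Reach C x s n) (hp : G.Passes C s n Mark.arrow) (hv : v ∉ G.ancSet C)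
    (ht : TransGen G.dirEdge v s) : G.Reach C x v Mark.tail := by
  induction ht using TransGen.head_induction_on with
  | single he => exact h.step (hG.1 _ _ _ _ he) hp
  | @head v u he _ ih =>
    have hu : u ∉ G.ancSet C :=
      fun hu => hv (mem_ancSet_of_ancestor (ReflTransGen.single he) hu)
    exact (ih hu).step (hG.1 _ _ _ _ he)
      (passes_tail_left.2 fun hC => hu (mem_ancSet_of_mem hC))

open Classical in
/-- The mark at `s` of an edge between `s` and `t` compatible with the ancestral relations. -/
noncomputable def endMark (G : MixedGraph V) (s t : V) : Mark :=
  if G.ancestor s t then Mark.tail else Mark.arrow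

theorem endMark_eq_tail {G : MixedGraph V} {s t : V} :
    G.endMark s t = Mark.tail ↔ G.ancestor s t := by
  unfold endMark; split_ifs <;> simp [*]

theorem endMark_eq_arrow {G : MixedGraph V} {s t : V} :
    G.endMark s t = Mark.arrow ↔ ¬ G.ancestor s t := by
  unfold endMark; split_ifs <;> simp [*]

/-- `u` can be entered with mark `n`, or in a way that is at least as good for continuing. -/
def AtLeastReach (G : MixedGraph V) (C : Set V) (x u : V) (n : Mark) : Prop :=
  G.Reach C x u n ∨ (n = Mark.tail ∧ u ∈ G.ancSet C ∧ G.Reach C x u Mark.arrow)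

theorem AtLeastReach.exists_reach {G : MixedGraph V} {C : Set V} {x u : V} {n m : Mark}
    (h : G.AtLeastReach C x u n) (hp : G.Passes C u n m) :
    ∃ n', G.Reach C x u n' ∧ G.Passes C u n' m := by
  rcases h with h | ⟨rfl, hu, h⟩
  · exact ⟨n, h, hp⟩
  · exact ⟨_, h, passes_of_mem_of_notMem hu (passes_tail_left.1 hp)⟩

namespace MWalk

variable {G : MixedGraph V} {w : MWalk G}

theorem IsInducing.mk₁_zero (hw : w.IsInducing) (hG : G.IsAncestral)
    (h : G.endMark (w.vtx 0) (w.vtx w.len) = Mark.arrow) : w.mk₁ 0 = Mark.arrow := by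
  rw [endMark_eq_arrow] at h
  obtain ⟨⟨-, -, h1, -⟩, hn, -, ha⟩ := hw.2 1 one_pos hw.1
  have he := w.isEdge 0 (by have := hw.1; omega)
  cases hm : w.mk₁ 0 with
  | arrow => rfl
  | tail =>
    simp only [Nat.sub_self] at h1
    rw [hm, h1] at he
    rcases ha with ha | ha
    · exact absurd ha (hG.not_ancestor_of_edge (hG.1.1 _ _ _ _ he))
    · exact absurd (ReflTransGen.head (show G.dirEdge _ _ from he) ha) h

theorem IsInducing.mk₂_last (hw : w.IsInducing) (hG : G.IsAncestral)
    (h : G.endMark (w.vtx w.len) (w.vtx 0) = Mark.arrow) :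
    w.mk₂ (w.len - 1) = Mark.arrow := by
  have := (hw.reverse hG.1).mk₁_zero hG (by simpa [MWalk.reverse] using h)
  simpa [MWalk.reverse] using this

theorem IsInducing.reach_inner (hw : w.IsInducing) (hG : G.IsAncestral)
    (hne : w.vtx 0 ≠ w.vtx w.len) {C : Set V} {x : V} {n : Mark}
    (hr : G.Reach C x (w.vtx 0) n)
    (hp : G.Passes C (w.vtx 0) n (G.endMark (w.vtx 0) (w.vtx w.len)))
    {k : ℕ} (hk0 : 0 < k) (hk : k < w.len) (h : G.Reach C x (w.vtx k) Mark.arrow) :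
    (∃ m, G.Reach C x (w.vtx k) m ∧ G.Passes C (w.vtx k) m Mark.arrow) ∨
      (G.Reach C x (w.vtx w.len) Mark.arrow ∧
        G.endMark (w.vtx w.len) (w.vtx 0) = Mark.arrow) := by
  by_cases hC : w.vtx k ∈ G.ancSet C
  · exact Or.inl ⟨_, h, passes_arrow_arrow.2 hC⟩
  obtain ⟨-, hn0, hnl, ha⟩ := hw.2 k hk0 hk
  by_cases hts : G.ancestor (w.vtx w.len) (w.vtx 0)
  · left
    have hst := hG.not_ancestor_symm hts hne.symm
    rw [endMark_eq_arrow.2 hst] at hp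
    have hks : G.ancestor (w.vtx k) (w.vtx 0) := ha.elim id fun ha => ReflTransGen.trans ha hts
    exact ⟨_, hr.backward hG.1 hp hC (transGen_of_ancestor hks hn0),
      passes_tail_left.2 fun h => hC (mem_ancSet_of_mem h)⟩
  · by_cases hkt : G.ancestor (w.vtx k) (w.vtx w.len)
    · exact Or.inr ⟨h.forward hC (transGen_of_ancestor hkt hnl), endMark_eq_arrow.2 hts⟩
    · left
      have hks := ha.resolve_right hkt
      by_cases hst : G.ancestor (w.vtx 0) (w.vtx w.len)
      · exact absurd (ReflTransGen.trans hks hst) hkt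
      rw [endMark_eq_arrow.2 hst] at hp
      exact ⟨_, hr.backward hG.1 hp hC (transGen_of_ancestor hks hn0),
        passes_tail_left.2 fun h => hC (mem_ancSet_of_mem h)⟩

theorem IsInducing.atLeastReach (hw : w.IsInducing) (hG : G.IsAncestral)
    (hne : w.vtx 0 ≠ w.vtx w.len) {C : Set V} {x : V} {n : Mark}
    (hr : G.Reach C x (w.vtx 0) n)
    (hp : G.Passes C (w.vtx 0) n (G.endMark (w.vtx 0) (w.vtx w.len))) :
    G.AtLeastReach C x (w.vtx w.len) (G.endMark (w.vtx w.len) (w.vtx 0)) := by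
  have hlen := hw.1
  by_cases hdone : G.Reach C x (w.vtx w.len) Mark.arrow ∧
      G.endMark (w.vtx w.len) (w.vtx 0) = Mark.arrow
  · exact Or.inl (hdone.2 ▸ hdone.1)
  have hfirst : G.Passes C (w.vtx 0) n (w.mk₁ 0) := by
    cases hm : G.endMark (w.vtx 0) (w.vtx w.len) with
    | arrow => rw [hw.mk₁_zero hG hm]; rwa [hm] at hp
    | tail =>
      rw [hm, passes_tail_right] at hp
      by_cases hC : w.vtx 0 ∈ G.ancSet C
      · exact passes_of_mem_of_notMem hC hp
      · have hst := endMark_eq_tail.1 hm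
        exact absurd ⟨hr.forward hC (transGen_of_ancestor hst hne),
          endMark_eq_arrow.2 (hG.not_ancestor_symm hst hne)⟩ hdone
  have key : ∀ k, k < w.len → ∃ m, G.Reach C x (w.vtx k) m ∧
      G.Passes C (w.vtx k) m (w.mk₁ k) := by
    intro k
    induction k with
    | zero => exact fun _ => ⟨n, hr, hfirst⟩
    | succ k ih =>
      intro hk
      obtain ⟨m, hm, hpm⟩ := ih (by omega)
      have hcol := (hw.2 (k + 1) (Nat.succ_pos k) hk).1
      have hstep := hm.step (w.isEdge k (by omega)) hpm
      rw [show w.mk₂ k = Mark.arrow from hcol.2.2.1] at hstep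
      rw [hcol.2.2.2]
      exact (hw.reach_inner hG hne hr hp (Nat.succ_pos k) hk hstep).resolve_right hdone
  obtain ⟨m, hm, hpm⟩ := key (w.len - 1) (by omega)
  have hlast := hm.step (w.isEdge (w.len - 1) (by omega)) hpm
  rw [Nat.sub_add_cancel (by omega)] at hlast
  cases hmt : G.endMark (w.vtx w.len) (w.vtx 0) with
  | arrow => rw [hw.mk₂_last hG hmt] at hlast; exact Or.inl hlast
  | tail =>
    cases hml : w.mk₂ (w.len - 1) with
    | tail => rw [hml] at hlast; exact Or.inl hlast
    | arrow =>
      rw [hml] at hlast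
      by_cases hC : w.vtx w.len ∈ G.ancSet C
      · exact Or.inr ⟨rfl, hC, hlast⟩
      · have hts := endMark_eq_tail.1 hmt
        rw [endMark_eq_arrow.2 (hG.not_ancestor_symm hts hne.symm)] at hp
        exact Or.inl (hr.backward hG.1 hp hC (transGen_of_ancestor hts hne.symm))

end MWalk

theorem markovEquiv_of_mConnected_iff {G H : MixedGraph V}
    (h : ∀ a b C, a ≠ b → (G.mConnected a b C ↔ H.mConnected a b C)) : MarkovEquiv G H := by
  intro A B C
  refine and_congr_right fun hd => forall₂_congr fun a ha => forall₂_congr fun b hb => ?_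
  rw [h a b C (hd.ne_of_mem ha hb)]

theorem MarkovEquiv.mConnected_iff {G H : MixedGraph V} (h : MarkovEquiv G H) {a b : V}
    (hne : a ≠ b) (C : Set V) : G.mConnected a b C ↔ H.mConnected a b C := by
  have := h {a} {b} C
  simp only [indep, mSep, Set.disjoint_singleton, ne_eq, hne, not_false_eq_true, true_and,
    Set.mem_singleton_iff, forall_eq] at this
  exact not_iff_not.1 this

theorem mConnected_of_edge {G : MixedGraph V} {a b : V} {m₁ m₂ : Mark} {C : Set V}
    (hne : a ≠ b) (h : G.edge a b m₁ m₂) (ha : a ∉ C) (hb : b ∉ C) : G.mConnected a b C := by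
  refine ⟨⟨1, fun i => if i = 0 then a else b, fun _ => m₁, fun _ => m₂, fun i hi => ?_⟩,
    ?_, rfl, rfl, ?_, ?_⟩
  · obtain rfl : i = 0 := by omega
    exact h
  · intro i j hi hj hij
    have hi : i ≤ 1 := hi
    have hj : j ≤ 1 := hj
    interval_cases i <;> interval_cases j <;> simp_all
  · rintro i ⟨h1, h2, -⟩
    have h2 : i < 1 := h2
    omega
  · intro i _ _
    dsimp only
    split_ifs <;> assumption

theorem isMaximal_of_separable {G : MixedGraph V}
    (h : ∀ a b, a ≠ b → ¬ G.adj a b → G.Separable a b) : G.IsMaximal := by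
  intro a b hne hadj m₁ m₂ heq
  obtain ⟨C, ha, hb, hC⟩ := h a b hne hadj
  exact hC ((heq.mConnected_iff hne C).1
    (mConnected_of_edge hne (Or.inr (Or.inl ⟨rfl, rfl, rfl, rfl⟩)) ha hb))

theorem ancestor_addEdge_endMark {G : MixedGraph V} {a b u v : V} :
    (G.addEdge a b (G.endMark a b) (G.endMark b a)).ancestor u v ↔ G.ancestor u v := by
  constructor
  · intro h
    induction h with
    | refl => exact ReflTransGen.refl
    | tail _ he ih =>
      refine ReflTransGen.trans ih ?_
      rcases he with he | ⟨rfl, rfl, he, -⟩ | ⟨rfl, rfl, he, -⟩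
      · exact ReflTransGen.single he
      · exact endMark_eq_tail.1 he.symm
      · exact endMark_eq_tail.1 he.symm
  · exact fun h => ReflTransGen.mono (fun _ _ he => Or.inl he) _ _ h

theorem IsAncestral.markovEquiv_addEdge {G : MixedGraph V} (hG : G.IsAncestral) {a b : V}
    (hne : a ≠ b) (hadj : ¬ G.adj a b) (hsep : ¬ G.Separable a b) :
    MarkovEquiv (G.addEdge a b (G.endMark a b) (G.endMark b a)) G := by
  obtain ⟨w, h0, hl, hw⟩ := hG.exists_isInducing hne hadj hsep
  obtain ⟨w', h0', hl', hw'⟩ := hG.exists_isInducing hne.symm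
    (fun ⟨m, n, h⟩ => hadj ⟨n, m, hG.1.1 _ _ _ _ h⟩) (fun h => hsep (h.symm hG.1))
  set L := G.addEdge a b (G.endMark a b) (G.endMark b a) with hL
  have hanc : ∀ C, L.ancSet C = G.ancSet C := fun C => by
    ext u
    simp only [ancSet, hL, ancestor_addEdge_endMark]
  have hpass : ∀ {C u n m}, L.Passes C u n m ↔ G.Passes C u n m := fun {C u n m} => by
    simp only [Passes, hanc]
  refine markovEquiv_of_mConnected_iff fun x y C hxy => ⟨fun h => ?_, fun h => ?_⟩
  · obtain ⟨hy, n, hr⟩ := exists_reach_of_mConnected h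
    have key : ∀ s : V × Mark, ReflTransGen (L.Step C) (x, Mark.tail) s →
        G.AtLeastReach C x s.1 s.2 := by
      intro s hs
      induction hs with
      | refl => exact Or.inl ReflTransGen.refl
      | @tail s t _ hst ih =>
        obtain ⟨m, he, hp⟩ := hst
        obtain ⟨n', hr', hp'⟩ := ih.exists_reach (hpass.1 hp)
        rcases he with he | ⟨hs, ht, rfl, hm⟩ | ⟨hs, ht, rfl, hm⟩
        · exact Or.inl (hr'.step he hp')
        · rw [ht, hm]
          rw [hs] at hr' hp'
          subst h0 hl
          exact hw.atLeastReach hG hne hr' hp'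
        · rw [ht, hm]
          rw [hs] at hr' hp'
          rw [← h0'] at hr'
          rw [← h0', ← hl'] at hp' ⊢
          exact hw'.atLeastReach hG (by rw [h0', hl']; exact hne.symm) hr' hp'
    rcases key _ hr with hr | ⟨-, -, hr⟩ <;> exact hr.mConnected hG hy
  · obtain ⟨w, hp, h0, hl, hc⟩ := h
    refine ⟨⟨w.len, w.vtx, w.mk₁, w.mk₂, fun i hi => Or.inl (w.isEdge i hi)⟩, hp, h0, hl,
      fun i hi => ?_, hc.2⟩
    obtain ⟨c, hcC, hac⟩ := hc.1 i hi
    exact ⟨c, hcC, ancestor_addEdge_endMark.2 hac⟩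

theorem IsAncestral.isMaximal_iff {G : MixedGraph V} (hG : G.IsAncestral) :
    G.IsMaximal ↔ ∀ a b, a ≠ b → ¬ G.adj a b → G.Separable a b :=
  ⟨fun h a b hne hadj => by_contra fun hsep =>
    h a b hne hadj _ _ (hG.markovEquiv_addEdge hne hadj hsep), isMaximal_of_separable⟩

theorem IsAncestral.separable_of_no_arrow {G : MixedGraph V} (hG : G.IsAncestral) {a b : V}
    (hne : a ≠ b) (hadj : ¬ G.adj a b) (ha : ∀ c m, ¬ G.edge c a m Mark.arrow) :
    G.Separable a b := by
  by_contra hsep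
  obtain ⟨w, rfl, rfl, hlen, hw⟩ := hG.exists_isInducing hne hadj hsep
  obtain ⟨⟨-, -, -, h1⟩, hn, -, hanc⟩ := hw (w.len - 1) (by omega) (by omega)
  have he := w.isEdge (w.len - 1) (by omega)
  rw [h1, Nat.sub_add_cancel (by omega)] at he
  rcases hanc with h | h
  · obtain ⟨c, -, hc⟩ := (ReflTransGen.cases_tail h).resolve_left (Ne.symm hn)
    exact ha c _ hc
  · exact hG.not_ancestor_of_edge he h

theorem anteriorGraph_edge_iff_of_not_selClosure {G : MixedGraph V} {a b : V} {m₁ m₂ : Mark}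
    (ha : ¬ G.selClosure a) (hb : ¬ G.selClosure b) :
    G.anteriorGraph.edge a b m₁ m₂ ↔ G.edge a b m₁ m₂ := by
  simp [anteriorGraph, ha, hb]

theorem anteriorGraph_ancestor_iff {G : MixedGraph V} {a b : V} (ha : ¬ G.selClosure a) :
    G.anteriorGraph.ancestor a b ↔ G.ancestor a b := by
  constructor
  · intro h
    suffices ¬ G.selClosure b ∧ G.ancestor a b from this.2
    induction h with
    | refl => exact ⟨ha, ReflTransGen.refl⟩
    | @tail c d _ he ih =>
      obtain ⟨hc, hac⟩ := ih
      have hd : ¬ G.selClosure d := by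
        obtain ⟨_, _, _, _, h | h⟩ := he
        · exact absurd h.2 (by simp)
        · exact h.1
      exact ⟨hd, hac.tail ((anteriorGraph_edge_iff_of_not_selClosure hc hd).1 he)⟩
  · intro h
    suffices ¬ G.selClosure b ∧ G.anteriorGraph.ancestor a b from this.2
    induction h with
    | refl => exact ⟨ha, ReflTransGen.refl⟩
    | @tail c d _ he ih =>
      obtain ⟨hc, hac⟩ := ih
      have hd : ¬ G.selClosure d := fun hd => hc (selClosure.step c d he hd)
      exact ⟨hd, hac.tail ((anteriorGraph_edge_iff_of_not_selClosure hc hd).2 he)⟩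

theorem MWalk.mConnecting_anteriorGraph_iff {G : MixedGraph V} (w : MWalk G)
    (w' : MWalk G.anteriorGraph) (hlen : w'.len = w.len) (hvtx : w'.vtx = w.vtx)
    (h₁ : ∀ i, i < w.len → (G.selClosure (w.vtx i) ∧ w'.mk₁ i = Mark.tail) ∨
      (¬ G.selClosure (w.vtx i) ∧ w'.mk₁ i = w.mk₁ i))
    (h₂ : ∀ i, i < w.len → (G.selClosure (w.vtx (i + 1)) ∧ w'.mk₂ i = Mark.tail) ∨
      (¬ G.selClosure (w.vtx (i + 1)) ∧ w'.mk₂ i = w.mk₂ i))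
    (hcol : ∀ i, w.colliderAt i → ¬ G.selClosure (w.vtx i)) (C : Set V) :
    w'.mConnecting C ↔ w.mConnecting C := by
  have hiff : ∀ i, w'.colliderAt i ↔ w.colliderAt i := by
    intro i
    constructor
    · rintro ⟨h0, hi, hm₂, hm₁⟩
      rw [hlen] at hi
      have e₁ := (h₁ i hi).resolve_left fun h => by simp [h.2] at hm₁
      have e₂ := (h₂ (i - 1) (by omega)).resolve_left fun h => by simp [h.2] at hm₂
      exact ⟨h0, hi, e₂.2 ▸ hm₂, e₁.2 ▸ hm₁⟩
    · intro hc
      have hs := hcol i hc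
      obtain ⟨h0, hi, hm₂, hm₁⟩ := hc
      have e₁ := (h₁ i hi).resolve_left fun h => hs h.1
      have e₂ := (h₂ (i - 1) (by omega)).resolve_left fun h =>
        hs (by simpa only [Nat.sub_add_cancel h0] using h.1)
      exact ⟨h0, hlen ▸ hi, e₂.2.trans hm₂, e₁.2.trans hm₁⟩
  simp only [mConnecting, hiff, hvtx, hlen]
  refine and_congr_left fun _ => forall₂_congr fun i hi => ?_
  simp only [anteriorGraph_ancestor_iff (hcol i hi)]

theorem mConnected_anteriorGraph_iff {G : MixedGraph V}
    (hcol : ∀ w : MWalk G, w.IsPath → ∀ i, w.colliderAt i → ¬ G.selClosure (w.vtx i))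
    {a b : V} {C : Set V} : G.anteriorGraph.mConnected a b C ↔ G.mConnected a b C := by
  constructor
  · rintro ⟨w', hp, h0, hl, hc⟩
    have : Nonempty Mark := ⟨Mark.tail⟩
    choose! n₁ n₂ he h₁ h₂ using w'.isEdge
    let w : MWalk G := ⟨w'.len, w'.vtx, n₁, n₂, he⟩
    exact ⟨w, hp, h0, hl,
      (w.mConnecting_anteriorGraph_iff w' rfl rfl h₁ h₂ (hcol w hp) C).1 hc⟩
  · rintro ⟨w, hp, h0, hl, hc⟩
    have hmark : ∀ (v : V) (m : Mark), ∃ m', (G.selClosure v ∧ m' = Mark.tail) ∨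
        (¬ G.selClosure v ∧ m' = m) := by
      intro v m
      by_cases hv : G.selClosure v <;> simp [hv]
    choose f hf using hmark
    let w' : MWalk G.anteriorGraph :=
      ⟨w.len, w.vtx, fun i => f (w.vtx i) (w.mk₁ i), fun i => f (w.vtx (i + 1)) (w.mk₂ i),
        fun i hi => ⟨_, _, w.isEdge i hi, hf _ _, hf _ _⟩⟩
    exact ⟨w', hp, h0, hl, (w.mConnecting_anteriorGraph_iff w' rfl rfl (fun i _ => hf _ _)
      (fun i _ => hf _ _) (hcol w hp) C).2 hc⟩

section InterventionGraph

variable {ι : Type} {G : MixedGraph V} {targets : ι → Set V}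

theorem not_interventionGraph_edge_inr_arrow {x : V ⊕ InterventionIndex targets}
    {k : InterventionIndex targets} {m : Mark} :
    ¬ (interventionGraph G targets).edge x (Sum.inr k) m Mark.arrow := by
  rcases x with a | k' <;> simp [interventionGraph]

theorem selClosure_interventionGraph_inl (hG : G.IsAncestral) {a : V} :
    (interventionGraph G targets).selClosure (Sum.inl a) ↔ G.selectionAdjacent a := by
  constructor
  · intro h
    generalize hx : (Sum.inl a : V ⊕ InterventionIndex targets) = x at h
    induction h generalizing a with
    | base y z h =>
      subst hx
      rcases z with b | k
      · exact ⟨b, Or.inl h⟩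
      · exact absurd h.2.1 (by simp)
    | base' y z h =>
      subst hx
      rcases z with b | k
      · exact ⟨b, Or.inr h⟩
      · exact absurd h.2.2 (by simp)
    | step y z h _ ih =>
      subst hx
      rcases z with b | k
      · exact absurd h (hG.2.2.2 b (ih rfl) _ _)
      · exact absurd h not_interventionGraph_edge_inr_arrow
  · rintro ⟨b, h | h⟩
    · exact selClosure.base _ (Sum.inl b) h
    · exact selClosure.base' _ (Sum.inl b) h

theorem anteriorGraph_interventionGraph_edge_inl (hG : G.IsAncestral) {a b : V}
    {m₁ m₂ : Mark} :
    (interventionGraph G targets).anteriorGraph.edge (Sum.inl a) (Sum.inl b) m₁ m₂ ↔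
      G.edge a b m₁ m₂ := by
  have aux : ∀ {a b : V} {n m n' : Mark}, G.edge b a n' n →
      ((G.selectionAdjacent a ∧ m = Mark.tail ∨ ¬ G.selectionAdjacent a ∧ m = n) ↔ m = n) := by
    intro a b n m n' h
    by_cases ha : G.selectionAdjacent a
    · cases n with
      | tail => simp [ha]
      | arrow => exact absurd h (hG.2.2.2 a ha _ _)
    · simp [ha]
  simp only [anteriorGraph, selClosure_interventionGraph_inl hG]
  constructor
  · rintro ⟨n₁, n₂, h, h₁, h₂⟩
    have h : G.edge a b n₁ n₂ := h
    rw [(aux (hG.1.1 _ _ _ _ h)).1 h₁, (aux h).1 h₂]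
    exact h
  · intro h
    exact ⟨m₁, m₂, h, (aux (hG.1.1 _ _ _ _ h)).2 rfl, (aux h).2 rfl⟩

theorem not_anteriorGraph_interventionGraph_edge_inr_arrow
    {x : V ⊕ InterventionIndex targets} {k : InterventionIndex targets} {m : Mark} :
    ¬ (interventionGraph G targets).anteriorGraph.edge x (Sum.inr k) m Mark.arrow := by
  rintro ⟨n₁, n₂, h, -, ⟨-, h₂⟩ | ⟨-, rfl⟩⟩
  · simp at h₂
  · exact not_interventionGraph_edge_inr_arrow h

theorem isLMG_interventionGraph (hG : G.IsLMG) : (interventionGraph G targets).IsLMG := by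
  constructor
  · rintro (a | k) (b | l) m₁ m₂ h
    · exact hG.1 _ _ _ _ h
    · exact ⟨h.1, h.2.2, h.2.1⟩
    · exact ⟨h.1, h.2.2, h.2.1⟩
    · exact h
  · rintro (a | k) m₁ m₂ h
    · exact hG.2 _ _ _ h
    · exact h

theorem isLMG_anteriorGraph (hG : G.IsLMG) : G.anteriorGraph.IsLMG := by
  constructor
  · rintro a b m₁ m₂ ⟨n₁, n₂, h, h₁, h₂⟩
    exact ⟨n₂, n₁, hG.1 _ _ _ _ h, h₂, h₁⟩
  · rintro a m₁ m₂ ⟨n₁, n₂, h, -⟩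
    exact hG.2 _ _ _ h

theorem transGen_dirEdge_anteriorGraph_interventionGraph (hG : G.IsAncestral)
    {x y : V ⊕ InterventionIndex targets}
    (h : TransGen (interventionGraph G targets).anteriorGraph.dirEdge x y) :
    ∃ b, y = Sum.inl b ∧ ∀ a, x = Sum.inl a → TransGen G.dirEdge a b := by
  induction h with
  | @single y h =>
    rcases y with b | k
    · refine ⟨b, rfl, ?_⟩
      rintro a rfl
      exact TransGen.single ((anteriorGraph_interventionGraph_edge_inl hG).1 h)
    · exact absurd h not_anteriorGraph_interventionGraph_edge_inr_arrow
  | @tail z y _ h ih =>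
    obtain ⟨c, rfl, hc⟩ := ih
    rcases y with b | k
    · exact ⟨b, rfl, fun a ha =>
        (hc a ha).tail ((anteriorGraph_interventionGraph_edge_inl hG).1 h)⟩
    · exact absurd h not_anteriorGraph_interventionGraph_edge_inr_arrow

theorem selClosure_of_anteriorGraph_undirEdge {a b : V}
    (h : G.anteriorGraph.undirEdge a b) : G.selClosure a := by
  by_contra ha
  obtain ⟨n₁, n₂, h, h₁, h₂⟩ := h
  obtain ⟨-, rfl⟩ := h₁.resolve_left fun h => ha h.1
  rcases h₂ with ⟨hb, -⟩ | ⟨-, rfl⟩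
  · cases n₂ with
    | tail => exact ha (selClosure.base a b h)
    | arrow => exact ha (selClosure.step a b h hb)
  · exact ha (selClosure.base a b h)

theorem isAncestral_anteriorGraph_interventionGraph (hG : G.IsAncestral) :
    (interventionGraph G targets).anteriorGraph.IsAncestral := by
  have hL := isLMG_anteriorGraph (isLMG_interventionGraph (targets := targets) hG.1)
  refine ⟨hL, fun x h => ?_, ?_, ?_⟩
  · obtain ⟨b, rfl, hb⟩ := transGen_dirEdge_anteriorGraph_interventionGraph hG h
    exact hG.2.1 b (hb b rfl)
  · have aux : ∀ x y, (interventionGraph G targets).anteriorGraph.bidirEdge x y →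
        ¬ TransGen (interventionGraph G targets).anteriorGraph.dirEdge x y := by
      intro x y h ht
      obtain ⟨b, rfl, hb⟩ := transGen_dirEdge_anteriorGraph_interventionGraph hG ht
      rcases x with a | k
      · exact (hG.2.2.1 a b ((anteriorGraph_interventionGraph_edge_inl hG).1 h)).1 (hb a rfl)
      · exact not_anteriorGraph_interventionGraph_edge_inr_arrow (hL.1 _ _ _ _ h)
    exact fun x y h => ⟨aux x y h, aux y x (hL.1 _ _ _ _ h)⟩
  · rintro x ⟨y, h⟩ z m ⟨n₁, n₂, -, -, h₂⟩
    have hx : (interventionGraph G targets).selClosure x :=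
      selClosure_of_anteriorGraph_undirEdge (h.elim id fun h => hL.1 _ _ _ _ h)
    rcases h₂ with h₂ | h₂
    · exact absurd h₂.2 (by simp)
    · exact h₂.1 hx

theorem not_selClosure_of_colliderAt (hG : G.IsAncestral)
    (hd : ∀ i, ¬ doublyIntervenes targets i) (w : MWalk (interventionGraph G targets))
    (hw : w.IsPath) {i : ℕ} (hi : w.colliderAt i) :
    ¬ (interventionGraph G targets).selClosure (w.vtx i) := by
  have hL := isLMG_interventionGraph (targets := targets) hG.1
  obtain ⟨h0, hlen, h₁, h₂⟩ := hi
  have e₁ := w.isEdge (i - 1) (by omega)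
  have e₂ := hL.1 _ _ _ _ (w.isEdge i hlen)
  rw [h₁, Nat.sub_add_cancel h0] at e₁
  rw [h₂] at e₂
  cases hv : w.vtx i with
  | inr k => rw [hv] at e₁; exact absurd e₁ not_interventionGraph_edge_inr_arrow
  | inl v =>
    rw [selClosure_interventionGraph_inl hG]
    intro hs
    have aux : ∀ {x m}, (interventionGraph G targets).edge x (Sum.inl v) m Mark.arrow →
        ∃ k, x = Sum.inr k ∧ v ∈ targets k.1 := by
      rintro (a | k) m h
      · exact absurd h (hG.2.2.2 v hs _ _)
      · exact ⟨k, rfl, h.1⟩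
    rw [hv] at e₁ e₂
    obtain ⟨k, hk, hvk⟩ := aux e₁
    obtain ⟨l, hl, hvl⟩ := aux e₂
    have hkl : k = l := Subtype.ext (by_contra fun h => hd v ⟨_, _, h, hvk, hvl⟩)
    have := hw (i - 1) (i + 1) (by omega) (by omega) (by rw [hk, hl, hkl])
    omega

theorem ancestor_inl_anteriorGraph_interventionGraph (hG : G.IsAncestral) {a : V}
    {y : V ⊕ InterventionIndex targets} :
    (interventionGraph G targets).anteriorGraph.ancestor (Sum.inl a) y ↔
      ∃ b, y = Sum.inl b ∧ G.ancestor a b := by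
  constructor
  · intro h
    rcases reflTransGen_iff_eq_or_transGen.1 h with rfl | h
    · exact ⟨a, rfl, ReflTransGen.refl⟩
    · obtain ⟨b, rfl, hb⟩ := transGen_dirEdge_anteriorGraph_interventionGraph hG h
      exact ⟨b, rfl, (hb a rfl).to_reflTransGen⟩
  · rintro ⟨b, rfl, h⟩
    exact ReflTransGen.lift Sum.inl
      (fun _ _ h => (anteriorGraph_interventionGraph_edge_inl hG).2 h) _ _ h

theorem separable_of_separable_anteriorGraph_interventionGraph (hG : G.IsAncestral) {a b : V}
    (h : (interventionGraph G targets).anteriorGraph.Separable (Sum.inl a) (Sum.inl b)) :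
    G.Separable a b := by
  obtain ⟨C, ha, hb, h⟩ := h
  refine ⟨Sum.inl ⁻¹' C, ha, hb, ?_⟩
  rintro ⟨w, hp, rfl, rfl, hc⟩
  refine h ⟨⟨w.len, fun i => Sum.inl (w.vtx i), w.mk₁, w.mk₂, fun i hi =>
    (anteriorGraph_interventionGraph_edge_inl hG).2 (w.isEdge i hi)⟩,
    fun i j hi hj hij => hp i j hi hj (Sum.inl_injective hij), rfl, rfl, fun i hi => ?_, hc.2⟩
  obtain ⟨c, hcC, hac⟩ := hc.1 i hi
  exact ⟨Sum.inl c, hcC, (ancestor_inl_anteriorGraph_interventionGraph hG).2 ⟨c, rfl, hac⟩⟩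

theorem separable_anteriorGraph_interventionGraph (hG : G.IsAncestral) {a b : V}
    (h : G.Separable a b) :
    (interventionGraph G targets).anteriorGraph.Separable (Sum.inl a) (Sum.inl b) := by
  have hL := isLMG_anteriorGraph (isLMG_interventionGraph (targets := targets) hG.1)
  obtain ⟨C, ha, hb, h⟩ := h
  refine ⟨Sum.inl '' C ∪ Set.range Sum.inr, by simpa using ha, by simpa using hb, ?_⟩
  rintro ⟨w, hp, h0, hl, hc⟩
  have hinl : ∀ i, ∃ v, i ≤ w.len → w.vtx i = Sum.inl v := by
    intro i
    by_cases hi : i ≤ w.len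
    · cases hv : w.vtx i with
      | inl v => exact ⟨v, fun _ => rfl⟩
      | inr k =>
        refine absurd (show w.vtx i ∈ _ by rw [hv]; exact Or.inr ⟨k, rfl⟩) (hc.2 i hi ?_)
        rintro ⟨h0, hlen, -, h₂⟩
        have e := hL.1 _ _ _ _ (w.isEdge i hlen)
        rw [h₂, hv] at e
        exact not_anteriorGraph_interventionGraph_edge_inr_arrow e
    · exact ⟨a, fun h => absurd h hi⟩
  choose f hf using hinl
  refine h ⟨⟨w.len, f, w.mk₁, w.mk₂, fun i hi => ?_⟩, fun i j hi hj hij => ?_, ?_, ?_,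
    fun i hi => ?_, fun i hi hcol hC => ?_⟩
  · have := w.isEdge i hi
    rw [hf i hi.le, hf (i + 1) hi] at this
    exact (anteriorGraph_interventionGraph_edge_inl hG).1 this
  · exact hp i j hi hj (by rw [hf i hi, hf j hj]; exact congrArg _ hij)
  · exact Sum.inl_injective ((hf 0 (Nat.zero_le _)).symm.trans h0)
  · exact Sum.inl_injective ((hf _ le_rfl).symm.trans hl)
  · obtain ⟨c, hcC, hac⟩ := hc.1 i hi
    rw [hf i hi.2.1.le, ancestor_inl_anteriorGraph_interventionGraph hG] at hac
    obtain ⟨d, rfl, had⟩ := hac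
    exact ⟨d, by simpa using hcC, had⟩
  · exact hc.2 i hi hcol (by rw [hf i hi]; exact Or.inl ⟨_, hC, rfl⟩)

end InterventionGraph

end MixedGraph

/-- Lemma: anterior graphs of interventions. Let `G` be an ancestral
graph on `[p]` and `𝓘` a multiset of intervention targets that does not doubly-intervene
on any node of `G`. Then `G` is maximal if and only if the anterior graph `(G^𝓘)*` is a
maximal ancestral graph that is Markov equivalent to `G^𝓘`. -/
theorem stmt5 {p : ℕ} {ι : Type} [Fintype ι] (G : MixedGraph (Fin p))
    (hG : G.IsAncestral) (targets : ι → Set (Fin p))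
    (hd : ∀ i : Fin p, ¬ doublyIntervenes targets i) :
    G.IsMaximal ↔
      ((interventionGraph G targets).anteriorGraph.IsAncestral ∧
        (interventionGraph G targets).anteriorGraph.IsMaximal ∧
        MixedGraph.MarkovEquiv (interventionGraph G targets).anteriorGraph
          (interventionGraph G targets)) := by
  have hK := MixedGraph.isAncestral_anteriorGraph_interventionGraph (targets := targets) hG
  have hequiv : MixedGraph.MarkovEquiv (interventionGraph G targets).anteriorGraph
      (interventionGraph G targets) :=
    MixedGraph.markovEquiv_of_mConnected_iff fun _ _ _ _ =>
      MixedGraph.mConnected_anteriorGraph_iff fun w hw _ hi =>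
        MixedGraph.not_selClosure_of_colliderAt hG hd w hw hi
  have hadj : ∀ a b, (interventionGraph G targets).anteriorGraph.adj (Sum.inl a) (Sum.inl b) ↔
      G.adj a b := fun a b => by
    simp only [MixedGraph.adj, MixedGraph.anteriorGraph_interventionGraph_edge_inl hG]
  rw [hG.isMaximal_iff, hK.isMaximal_iff]
  refine ⟨fun h => ⟨hK, ?_, hequiv⟩, fun ⟨_, h, _⟩ a b hne hab => ?_⟩
  · rintro (a | k) (b | l) hne hab
    · exact MixedGraph.separable_anteriorGraph_interventionGraph hG
        (h a b (fun h => hne (congrArg _ h)) fun h => hab ((hadj a b).2 h))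
    · refine (hK.separable_of_no_arrow hne.symm
        (fun ⟨m, n, h⟩ => hab ⟨n, m, hK.1.1 _ _ _ _ h⟩) fun _ _ => ?_).symm hK.1
      exact MixedGraph.not_anteriorGraph_interventionGraph_edge_inr_arrow
    · exact hK.separable_of_no_arrow hne hab fun _ _ =>
        MixedGraph.not_anteriorGraph_interventionGraph_edge_inr_arrow
    · exact hK.separable_of_no_arrow hne hab fun _ _ =>
        MixedGraph.not_anteriorGraph_interventionGraph_edge_inr_arrow
  · exact MixedGraph.separable_of_separable_anteriorGraph_interventionGraph hG
      (h _ _ (fun h => hne (Sum.inl_injective h)) fun h => hab ((hadj a b).1 h))
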